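/- Let d ≥ 2, p ∈ [2, ∞) and ε > 0. There exists a constant C(d, p, ε) ≥ 1 such that for every sequence (c_n)_{n∈ℕ} of nonnegative reals: ( ∑_{n≥0} (1+n)^{−d(1/2 − 1/p) − ε} c_n² )^{1/2} + ( ∑_{n≥0} [ (1+n)^{−d(1/2 − 1/p)} c_n² ]^{p/2} )^{1/p} ≤ C(d, p, ε) · ‖ √( ∑_{n≥0} c_n² · e_d(n, x) / D(d,n) ) ‖_{L^p_x(ℝ^d)}, both sides being possibly infinite. -/

import Mathlib

open MeasureTheory
open scoped ENNReal NNReal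

/-- The `n`-th physicists' Hermite polynomial `H_n(x) = (−1)^n e^{x²} (d/dx)^n e^{−x²}`. -/
noncomputable def hermitePoly (n : ℕ) (x : ℝ) : ℝ :=
  (-1 : ℝ) ^ n * Real.exp (x ^ 2) * iteratedDeriv n (fun t => Real.exp (-t ^ 2)) x

/-- The `n`-th (L²-normalized) Hermite function
`h_n(x) = H_n(x) e^{−x²/2} / √(n! 2^n √π)`. -/
noncomputable def hermiteFun (n : ℕ) (x : ℝ) : ℝ :=
  hermitePoly n x * Real.exp (-x ^ 2 / 2) /
    Real.sqrt ((n.factorial : ℝ) * 2 ^ n * Real.sqrt Real.pi)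

/-- The spectral function of the `n`-th eigenspace of the harmonic oscillator `−Δ + |x|²`
on `ℝ^d`: `e_d(n, x) = ∑_{i₁+⋯+i_d = n} h_{i₁}(x₁)² ⋯ h_{i_d}(x_d)²`. -/
noncomputable def eSpec (d n : ℕ) (x : Fin d → ℝ) : ℝ :=
  ∑ i ∈ Finset.Nat.antidiagonalTuple d n, ∏ k, (hermiteFun (i k) (x k)) ^ 2

/-- `D(d, n) = binom(n+d−1, d−1)`, the dimension of the `n`-th eigenspace. -/
def Ddim (d n : ℕ) : ℕ := Nat.choose (n + d - 1) (d - 1)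

/-- The probabilistic Lebesgue norm `‖√(∑_n c_n² e_d(n,·)/D(d,n))‖_{L^p(ℝ^d)}`,
computed in `[0, ∞]`. -/
noncomputable def hermitePLnorm (d : ℕ) (p : ℝ) (c : ℕ → ℝ) : ℝ≥0∞ :=
  (∫⁻ x : Fin d → ℝ,
      (∑' n : ℕ, ENNReal.ofReal ((c n) ^ 2 * eSpec d n x / (Ddim d n))) ^ (p / 2)
    ∂volume) ^ (1 / p)


open Polynomial in
/-- Hermite polynomials as polynomials. -/
noncomputable def HP : ℕ → Polynomial ℝ
  | 0 => 1
  | n + 1 => 2 * X * HP n - derivative (HP n)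

open Polynomial in
lemma HP_deriv (n : ℕ) : derivative (HP (n + 1)) = C (2 * ((n : ℝ) + 1)) * HP n := by
  induction n with
  | zero => simp [HP, ← C_ofNat]
  | succ k ih =>
    have h1 : HP (k + 2) = 2 * X * HP (k + 1) - derivative (HP (k + 1)) := rfl
    have h2 : HP (k + 1) = 2 * X * HP k - derivative (HP k) := rfl
    rw [h1, ih]
    simp only [derivative_sub, derivative_mul, derivative_C, derivative_X, derivative_ofNat, ih]
    have h3 : derivative (HP k) = 2 * X * HP k - HP (k + 1) := by rw [h2]; ring
    rw [h3]
    simp only [map_mul, map_add, Nat.cast_add, Nat.cast_one, C_1, map_ofNat]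
    ring

open Polynomial in
lemma iteratedDeriv_gauss (n : ℕ) :
    iteratedDeriv n (fun t : ℝ => Real.exp (-t ^ 2)) =
      fun x => (-1) ^ n * (HP n).eval x * Real.exp (-x ^ 2) := by
  induction n with
  | zero => simp [HP]
  | succ k ih =>
    rw [iteratedDeriv_succ, ih]
    funext x
    have h1 : HasDerivAt (fun x : ℝ => Real.exp (-x ^ 2)) (Real.exp (-x ^ 2) * (-(2 * x))) x := by
      have := ((hasDerivAt_pow 2 x).neg).exp
      simpa using this
    have := (((HP k).hasDerivAt x).const_mul ((-1 : ℝ) ^ k)).mul h1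
    have h2 := this.deriv
    simp only [Pi.mul_def] at h2
    rw [h2]
    simp [HP]
    ring

lemma hermitePoly_eq (n : ℕ) (x : ℝ) : hermitePoly n x = (HP n).eval x := by
  unfold hermitePoly
  rw [iteratedDeriv_gauss]
  have h : Real.exp (x ^ 2) * Real.exp (-x ^ 2) = 1 := by rw [← Real.exp_add]; simp
  have h' : ((-1 : ℝ) ^ n) * (-1) ^ n = 1 := by rw [← mul_pow]; simp
  linear_combination (HP n).eval x * ((-1 : ℝ) ^ n * (-1) ^ n) * h + (HP n).eval x * h'

lemma poly_int (P : Polynomial ℝ) : Integrable (fun x : ℝ => P.eval x * Real.exp (-x ^ 2)) := by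
  induction P using Polynomial.induction_on' with
  | add p q hp hq =>
    have := hp.add hq
    simp only [Polynomial.eval_add, add_mul]
    exact this
  | monomial n a =>
    have := integrable_rpow_mul_exp_neg_mul_sq (b := 1) one_pos (s := n)
      (by have : (0 : ℝ) ≤ n := n.cast_nonneg
          linarith)
    simpa [mul_assoc] using this.const_mul a

noncomputable def LG (P : Polynomial ℝ) : ℝ := ∫ x : ℝ, P.eval x * Real.exp (-x ^ 2)

lemma LG_add (P Q : Polynomial ℝ) : LG (P + Q) = LG P + LG Q := by
  unfold LG
  rw [← integral_add (poly_int P) (poly_int Q)]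
  simp [add_mul]

lemma LG_C (a : ℝ) (Q : Polynomial ℝ) : LG (Polynomial.C a * Q) = a * LG Q := by
  unfold LG
  rw [← integral_const_mul]
  simp [mul_assoc]

lemma LG_sub (P Q : Polynomial ℝ) : LG (P - Q) = LG P - LG Q := by
  have := LG_add (P - Q) Q
  simp at this
  linarith

open Polynomial in
lemma LG_ibp (P : Polynomial ℝ) : LG (2 * X * P - derivative P) = 0 := by
  have h : ∫ x : ℝ, (derivative P - 2 * X * P).eval x * Real.exp (-x ^ 2) = 0 := by
    refine integral_eq_zero_of_hasDerivAt_of_integrable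
      (f := fun x => P.eval x * Real.exp (-x ^ 2)) (fun x => ?_) (poly_int _) (poly_int _)
    have h1 : HasDerivAt (fun x : ℝ => Real.exp (-x ^ 2)) (Real.exp (-x ^ 2) * (-(2 * x))) x := by
      have := ((hasDerivAt_pow 2 x).neg).exp
      simpa using this
    convert! (P.hasDerivAt x).mul h1 using 1
    simp
    ring
  have h2 : 2 * X * P - derivative P = C (-1) * (derivative P - 2 * X * P) := by
    simp
  rw [h2, LG_C]
  unfold LG
  rw [h]; simp

open Polynomial in
lemma LG_sq (n : ℕ) : LG (HP n * HP n) = n.factorial * 2 ^ n * Real.sqrt Real.pi := by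
  induction n with
  | zero =>
    have := integral_gaussian 1
    simp at this
    simp [LG, HP, this]
  | succ k ih =>
    have h := LG_ibp (HP k * HP (k + 1))
    have e : 2 * X * (HP k * HP (k + 1)) - derivative (HP k * HP (k + 1))
        = HP (k + 1) * HP (k + 1) - C (2 * ((k : ℝ) + 1)) * (HP k * HP k) := by
      rw [derivative_mul, HP_deriv]
      have h2 : HP (k + 1) = 2 * X * HP k - derivative (HP k) := rfl
      rw [h2]; ring
    rw [e, LG_sub, LG_C, ih] at h
    rw [Nat.factorial_succ]
    push_cast
    rw [pow_succ]
    linarith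

open Polynomial in
lemma LG_mom (n : ℕ) : LG (X ^ 2 * (HP n * HP n)) ≤
    (2 * n + 1) * (n.factorial * 2 ^ n * Real.sqrt Real.pi) := by
  have hs : 0 ≤ Real.sqrt Real.pi := Real.sqrt_nonneg _
  have key : ∃ Q : Polynomial ℝ, derivative (HP n) = Q ∧
      LG (Q * Q) = 2 * n * (n.factorial * 2 ^ n * Real.sqrt Real.pi) := by
    refine ⟨_, rfl, ?_⟩
    cases n with
    | zero => simp [HP, LG]
    | succ k =>
      rw [HP_deriv, show C (2 * ((k : ℝ) + 1)) * HP k * (C (2 * ((k : ℝ) + 1)) * HP k) =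
        C (2 * ((k : ℝ) + 1)) * (C (2 * ((k : ℝ) + 1)) * (HP k * HP k)) by ring, LG_C, LG_C, LG_sq,
        Nat.factorial_succ]
      push_cast
      ring
  obtain ⟨Q, hQ, hQ2⟩ := key
  have h2 : HP (n + 1) = 2 * X * HP n - derivative (HP n) := rfl
  have h4 : LG (C 4 * (X ^ 2 * (HP n * HP n))) ≤
      LG (C 2 * (HP (n + 1) * HP (n + 1)) + C 2 * (Q * Q)) := by
    refine integral_mono (poly_int _) (poly_int _) (fun x => ?_)
    refine mul_le_mul_of_nonneg_right ?_ (Real.exp_pos _).le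
    rw [h2, hQ]
    simp
    nlinarith [sq_nonneg ((2 * x * (HP n).eval x - Q.eval x) - Q.eval x)]
  rw [LG_add, LG_C, LG_C, LG_C, hQ2, LG_sq, Nat.factorial_succ] at h4
  push_cast at h4
  rw [pow_succ (2 : ℝ) n] at h4
  linarith

lemma hermiteFun_sq (n : ℕ) (x : ℝ) : hermiteFun n x ^ 2 =
    ((HP n * HP n).eval x * Real.exp (-x ^ 2)) / (n.factorial * 2 ^ n * Real.sqrt Real.pi) := by
  unfold hermiteFun
  rw [div_pow, Real.sq_sqrt (by positivity), hermitePoly_eq, mul_pow, ← Real.exp_nat_mul,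
    Polynomial.eval_mul, sq]
  congr 3
  push_cast; ring

lemma hermiteFun_int (n : ℕ) : Integrable (fun x => hermiteFun n x ^ 2) := by
  simp_rw [hermiteFun_sq]
  exact (poly_int _).div_const _

lemma nrm_pos (n : ℕ) : 0 < (n.factorial * 2 ^ n * Real.sqrt Real.pi : ℝ) := by
  have := Real.sqrt_pos.2 Real.pi_pos
  positivity

lemma hermiteFun_mass (n : ℕ) : ∫ x, hermiteFun n x ^ 2 = 1 := by
  simp_rw [hermiteFun_sq]
  rw [integral_div]
  have := LG_sq n
  unfold LG at this
  rw [this, div_self (nrm_pos n).ne']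

lemma hermiteFun_mom_int (n : ℕ) : Integrable (fun x => x ^ 2 * hermiteFun n x ^ 2) := by
  simp_rw [hermiteFun_sq]
  have := (poly_int (Polynomial.X ^ 2 * (HP n * HP n))).div_const
    (n.factorial * 2 ^ n * Real.sqrt Real.pi)
  convert! this using 2 with x
  simp
  ring

lemma hermiteFun_mom (n : ℕ) : ∫ x, x ^ 2 * hermiteFun n x ^ 2 ≤ 2 * n + 1 := by
  have h := LG_mom n
  rw [← div_le_iff₀ (nrm_pos n)] at h
  unfold LG at h
  rw [← integral_div] at h
  refine le_trans (le_of_eq ?_) h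
  congr 1
  funext x
  rw [hermiteFun_sq]
  simp
  ring

lemma hermiteFun_box (n : ℕ) (R : ℝ) (hR0 : 0 < R) (hR : 2 * (2 * n + 1) ≤ R ^ 2) :
    (1 / 2 : ℝ) ≤ ∫ x in Set.Icc (-R) R, hermiteFun n x ^ 2 := by
  rw [← integral_indicator measurableSet_Icc]
  have h : ∫ x, (hermiteFun n x ^ 2 - (x ^ 2 * hermiteFun n x ^ 2) / R ^ 2) ≤
      ∫ x, (Set.Icc (-R) R).indicator (fun x => hermiteFun n x ^ 2) x := by
    refine integral_mono ((hermiteFun_int n).sub ((hermiteFun_mom_int n).div_const _))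
      ((hermiteFun_int n).indicator measurableSet_Icc) (fun x => ?_)
    have h0 := sq_nonneg (hermiteFun n x)
    by_cases hx : x ∈ Set.Icc (-R) R
    · simp only [Set.indicator_of_mem hx]
      have : 0 ≤ x ^ 2 * hermiteFun n x ^ 2 / R ^ 2 := by positivity
      linarith
    · simp only [Set.indicator_of_notMem hx]
      have hx2 : R ^ 2 ≤ x ^ 2 := by
        by_contra hc
        exact hx (abs_le.1 (abs_le_of_sq_le_sq (not_le.1 hc).le hR0.le))
      have : hermiteFun n x ^ 2 ≤ x ^ 2 * hermiteFun n x ^ 2 / R ^ 2 := by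
        rw [le_div_iff₀ (by positivity)]
        nlinarith
      linarith
  rw [integral_sub (hermiteFun_int n) ((hermiteFun_mom_int n).div_const _), integral_div,
    hermiteFun_mass] at h
  have h2 : (∫ x, x ^ 2 * hermiteFun n x ^ 2) / R ^ 2 ≤ 1 / 2 := by
    rw [div_le_iff₀ (by positivity)]
    have := hermiteFun_mom n
    linarith
  linarith

lemma hermiteFun_cont (n : ℕ) : Continuous (hermiteFun n) := by
  unfold hermiteFun
  simp_rw [hermitePoly_eq]
  fun_prop

lemma eSpec_cont (d n : ℕ) : Continuous (eSpec d n) := by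
  unfold eSpec
  refine continuous_finsetSum _ (fun i _ => continuous_finsetProd _ (fun k _ => ?_))
  exact ((hermiteFun_cont _).comp (continuous_apply k)).pow 2

lemma eSpec_nonneg (d n : ℕ) (x : Fin d → ℝ) : 0 ≤ eSpec d n x := by
  unfold eSpec
  exact Finset.sum_nonneg (fun i _ => Finset.prod_nonneg (fun k _ => sq_nonneg _))

lemma card_tuple (d n : ℕ) (hd : 1 ≤ d) :
    (Finset.Nat.antidiagonalTuple d n).card = Ddim d n := by
  obtain ⟨k, rfl⟩ : ∃ k, d = k + 1 := ⟨d - 1, by omega⟩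
  have h := Finset.card_finsuppAntidiag_nat_eq_choose (s := (Finset.univ : Finset (Fin (k + 1)))) n
  unfold Ddim
  have e : (Finset.Nat.antidiagonalTuple (k + 1) n).card =
      (Finset.finsuppAntidiag (Finset.univ : Finset (Fin (k + 1))) n).card := by
    refine Finset.card_bij' (fun i _ => Finsupp.equivFunOnFinite.symm i)
      (fun f _ => (f : Fin (k + 1) → ℕ)) ?_ ?_ ?_ ?_
    · intro a ha
      rw [Finset.Nat.mem_antidiagonalTuple] at ha
      simp [Finset.mem_finsuppAntidiag, ha]
    · intro a ha
      rw [Finset.mem_finsuppAntidiag] at ha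
      rw [Finset.Nat.mem_antidiagonalTuple]
      exact ha.1
    · intro a _; ext; simp
    · intro a _; ext; simp
  rw [e, h]
  simp only [Finset.card_univ, Fintype.card_fin]
  rw [← Nat.choose_symm_of_eq_add (a := k)]
  all_goals first | omega | (congr 1; omega)

lemma eSpec_box (d n : ℕ) (hd : 1 ≤ d) :
    ((1 / 2 : ℝ) ^ d) ≤ ∫ x in Metric.closedBall (0 : Fin d → ℝ) (2 * Real.sqrt (n + 1)),
      eSpec d n x / Ddim d n := by
  set R := 2 * Real.sqrt ((n : ℝ) + 1) with hR
  have hR0 : 0 < R := by positivity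
  have hR2 : R ^ 2 = 4 * (n + 1) := by
    rw [hR, mul_pow, Real.sq_sqrt (by positivity)]; norm_num
  have hball : Metric.closedBall (0 : Fin d → ℝ) R =
      Set.univ.pi (fun _ => Set.Icc (-R) R) := by
    rw [closedBall_pi _ hR0.le]
    simp [Real.closedBall_eq_Icc]
  have hD : 0 < Ddim d n := by
    unfold Ddim; exact Nat.choose_pos (by omega)
  have hDr : (0 : ℝ) < Ddim d n := by exact_mod_cast hD
  rw [integral_div, le_div_iff₀ hDr]
  unfold eSpec
  rw [integral_finsetSum]
  · rw [hball, volume_pi, Measure.restrict_pi_pi]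
    calc _ = ∑ i ∈ Finset.Nat.antidiagonalTuple d n, (1 / 2 : ℝ) ^ d := by
          rw [Finset.sum_const, card_tuple d n hd, nsmul_eq_mul, mul_comm]
      _ ≤ _ := by
          refine Finset.sum_le_sum (fun i hi => ?_)
          rw [integral_fintype_prod_eq_prod (f := fun k y => hermiteFun (i k) y ^ 2)]
          calc (1 / 2 : ℝ) ^ d = ∏ k : Fin d, (1 / 2 : ℝ) := by simp
            _ ≤ _ := by
              refine Finset.prod_le_prod (fun _ _ => by norm_num) (fun k _ => ?_)
              refine hermiteFun_box _ _ hR0 ?_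
              rw [hR2]
              have : i k ≤ n := by
                rw [Finset.Nat.mem_antidiagonalTuple] at hi
                rw [← hi]
                exact Finset.single_le_sum (fun _ _ => Nat.zero_le _) (Finset.mem_univ k)
              have : (i k : ℝ) ≤ n := by exact_mod_cast this
              linarith
  · intro i _
    refine ContinuousOn.integrableOn_compact (isCompact_closedBall _ _) ?_
    refine (continuous_finsetProd _ (fun k _ => ?_)).continuousOn
    exact ((hermiteFun_cont _).comp (continuous_apply k)).pow 2

/-- normalized density -/
noncomputable def phi (d n : ℕ) (x : Fin d → ℝ) : ℝ≥0∞ := ENNReal.ofReal (eSpec d n x / Ddim d n)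

lemma phi_meas (d n : ℕ) : Measurable (phi d n) :=
  ((eSpec_cont d n).div_const _).measurable.ennreal_ofReal

lemma phi_box (d n : ℕ) (hd : 1 ≤ d) :
    ENNReal.ofReal ((1 / 2 : ℝ) ^ d) ≤
      ∫⁻ x in Metric.closedBall (0 : Fin d → ℝ) (2 * Real.sqrt (n + 1)), phi d n x := by
  unfold phi
  rw [← ofReal_integral_eq_lintegral_ofReal]
  · exact ENNReal.ofReal_le_ofReal (eSpec_box d n hd)
  · exact ContinuousOn.integrableOn_compact (isCompact_closedBall _ _)
      ((eSpec_cont d n).div_const _).continuousOn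
  · exact Filter.Eventually.of_forall (fun x => div_nonneg (eSpec_nonneg d n x) (by positivity))

lemma holder_gen {α : Type*} [MeasurableSpace α] (μ : Measure α) (q : ℝ) (hq : 1 ≤ q)
    (F g : α → ℝ≥0∞) (hF : AEMeasurable F μ) (hg : AEMeasurable g μ) (hg1 : ∀ x, g x ≤ 1)
    (K : ℝ≥0∞) (hK : 1 < q → ∫⁻ x, g x ^ (q / (q - 1)) ∂μ ≤ K) :
    ∫⁻ x, F x * g x ∂μ ≤ (∫⁻ x, F x ^ q ∂μ) ^ (1 / q) * K ^ (1 - 1 / q) := by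
  rcases eq_or_lt_of_le hq with h | h
  · subst h
    simp only [ENNReal.rpow_one, div_one, sub_self, ENNReal.rpow_zero, mul_one]
    exact lintegral_mono (fun x => mul_le_of_le_one_right' (hg1 x))
  · have hc : q.HolderConjugate (q / (q - 1)) := Real.HolderConjugate.conjExponent h
    have := ENNReal.lintegral_mul_le_Lp_mul_Lq μ hc hF hg
    refine le_trans this ?_
    have e : 1 / (q / (q - 1)) = 1 - 1 / q := by
      have : q ≠ 0 := by linarith
      have : q - 1 ≠ 0 := by linarith
      field_simp
    rw [e]
    refine mul_le_mul_right (ENNReal.rpow_le_rpow (hK h) ?_) _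
    rw [← e]; exact one_div_nonneg.2 hc.symm.nonneg

lemma tsum_rpow_le (q : ℝ) (hq : 1 ≤ q) (a : ℕ → ℝ≥0∞) : ∑' n, a n ^ q ≤ (∑' n, a n) ^ q := by
  have hfin : ∀ s : Finset ℕ, ∑ n ∈ s, a n ^ q ≤ (∑ n ∈ s, a n) ^ q := by
    intro s
    induction s using Finset.induction_on with
    | empty => simp
    | insert i s hi ih =>
      rw [Finset.sum_insert hi, Finset.sum_insert hi]
      exact le_trans (add_le_add le_rfl ih) (ENNReal.add_rpow_le_rpow_add _ _ hq)
  rw [ENNReal.tsum_eq_iSup_sum]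
  exact iSup_le (fun s => (hfin s).trans
    (ENNReal.rpow_le_rpow (ENNReal.sum_le_tsum s) (by linarith)))

lemma natcast_rpow (n : ℕ) (s : ℝ) :
    ((1 + n : ℕ) : ℝ≥0∞) ^ s = ENNReal.ofReal (((n : ℝ) + 1) ^ s) := by
  rw [← ENNReal.ofReal_rpow_of_pos (by positivity), ← ENNReal.ofReal_natCast]
  push_cast
  rw [add_comm]

lemma sqrt_rpow (n : ℕ) (s : ℝ) : (Real.sqrt ((n : ℝ) + 1)) ^ s = ((n : ℝ) + 1) ^ (s / 2) := by
  rw [Real.sqrt_eq_rpow, ← Real.rpow_mul (by positivity)]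
  congr 1; ring

lemma partA (d : ℕ) (hd : 1 ≤ d) (q : ℝ) (hq : 1 ≤ q) (ε : ℝ) (hε : 0 < ε) :
    ∃ C : ℝ≥0∞, C ≠ ∞ ∧ ∀ u : ℕ → ℝ≥0∞,
      ∑' n : ℕ, ((1 + n : ℕ) : ℝ≥0∞) ^ (-((d : ℝ) / 2 * (1 - 1 / q)) - ε) * u n ≤
        C * (∫⁻ x, (∑' n, u n * phi d n x) ^ q) ^ (1 / q) := by
  set r : ℝ := d * (1 - 1 / q) + 2 * ε with hr
  have hq1 : 0 ≤ 1 - 1 / q := by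
    rw [sub_nonneg, div_le_one (by linarith)]; exact hq
  have hr0 : 0 < r := by positivity
  set g : (Fin d → ℝ) → ℝ≥0∞ := fun x => ENNReal.ofReal ((1 + ‖x‖) ^ (-r)) with hg
  have hgm : Measurable g := by
    have : Measurable fun x : Fin d → ℝ => (1 + ‖x‖) ^ (-r) := by fun_prop
    exact this.ennreal_ofReal
  have hg1 : ∀ x, g x ≤ 1 := by
    intro x
    rw [hg]
    simp only [ENNReal.ofReal_le_one]
    exact Real.rpow_le_one_of_one_le_of_nonpos (by linarith [norm_nonneg x]) (by linarith)
  obtain ⟨K, hKt, hK⟩ : ∃ K : ℝ≥0∞, K ≠ ∞ ∧ (1 < q → ∫⁻ x, g x ^ (q / (q - 1)) ≤ K) := by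
    by_cases h : 1 < q
    · have hfin := finite_integral_one_add_norm (E := Fin d → ℝ) (μ := volume)
        (r := r * (q / (q - 1))) (by
          rw [Module.finrank_fin_fun]
          have h1 : 0 < q - 1 := by linarith
          have : r * (q / (q - 1)) = d + 2 * ε * (q / (q - 1)) := by
            rw [hr]; field_simp
          rw [this]
          have : 0 < 2 * ε * (q / (q - 1)) := by positivity
          linarith)
      refine ⟨_, hfin.ne, fun _ => le_of_eq ?_⟩
      refine lintegral_congr (fun x => ?_)
      have hx : 0 < 1 + ‖x‖ := by positivity
      rw [hg]
      simp only
      rw [ENNReal.ofReal_rpow_of_pos (by positivity), ← Real.rpow_mul hx.le]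
      congr 2; ring
    · exact ⟨1, by simp, fun h' => absurd h' h⟩
  set κ : ℝ≥0∞ := ENNReal.ofReal ((3 : ℝ) ^ (-r) * (1 / 2 : ℝ) ^ d) with hκ
  have hκ0 : κ ≠ 0 := by
    rw [hκ, Ne, ENNReal.ofReal_eq_zero, not_le]; positivity
  have hκt : κ ≠ ∞ := ENNReal.ofReal_ne_top
  have low : ∀ n : ℕ, κ * ((1 + n : ℕ) : ℝ≥0∞) ^ (-((d : ℝ) / 2 * (1 - 1 / q)) - ε) ≤
      ∫⁻ x, phi d n x * g x := by
    intro n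
    have hs1 : 1 ≤ Real.sqrt ((n : ℝ) + 1) := by
      rw [Real.one_le_sqrt]; linarith [(Nat.cast_nonneg n : (0 : ℝ) ≤ n)]
    set R := 2 * Real.sqrt ((n : ℝ) + 1) with hR
    have hexp : -((d : ℝ) / 2 * (1 - 1 / q)) - ε = (-r) / 2 := by rw [hr]; ring
    calc κ * ((1 + n : ℕ) : ℝ≥0∞) ^ (-((d : ℝ) / 2 * (1 - 1 / q)) - ε)
        = ENNReal.ofReal ((1 / 2 : ℝ) ^ d) *
            ENNReal.ofReal ((3 * Real.sqrt ((n : ℝ) + 1)) ^ (-r)) := by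
          rw [natcast_rpow, hκ, ← ENNReal.ofReal_mul (by positivity),
            ← ENNReal.ofReal_mul (by positivity), Real.mul_rpow (by norm_num) (by positivity),
            sqrt_rpow, hexp]
          congr 1; ring
      _ ≤ (∫⁻ x in Metric.closedBall (0 : Fin d → ℝ) R, phi d n x) *
            ENNReal.ofReal ((3 * Real.sqrt ((n : ℝ) + 1)) ^ (-r)) :=
          mul_le_mul_left (phi_box d n hd) _
      _ = ∫⁻ x in Metric.closedBall (0 : Fin d → ℝ) R, phi d n x *
            ENNReal.ofReal ((3 * Real.sqrt ((n : ℝ) + 1)) ^ (-r)) :=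
          (lintegral_mul_const _ (phi_meas d n)).symm
      _ ≤ ∫⁻ x in Metric.closedBall (0 : Fin d → ℝ) R, phi d n x * g x := by
          refine setLIntegral_mono ((phi_meas d n).mul hgm) (fun x hx => ?_)
          refine mul_le_mul_right (ENNReal.ofReal_le_ofReal ?_) _
          have hx' : ‖x‖ ≤ R := by simpa using hx
          refine Real.rpow_le_rpow_of_nonpos (by positivity) ?_ (by linarith)
          linarith
      _ ≤ _ := setLIntegral_le_lintegral _ _
  refine ⟨κ⁻¹ * K ^ (1 - 1 / q), ENNReal.mul_ne_top (ENNReal.inv_ne_top.2 hκ0)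
    (ENNReal.rpow_ne_top_of_nonneg hq1 hKt), fun u => ?_⟩
  have hFm : Measurable (fun x => ∑' n, u n * phi d n x) :=
    Measurable.tsum (fun n => (phi_meas d n).const_mul _)
  have H := holder_gen volume q hq _ g hFm.aemeasurable hgm.aemeasurable hg1 K hK
  have hS : κ * ∑' n : ℕ, ((1 + n : ℕ) : ℝ≥0∞) ^ (-((d : ℝ) / 2 * (1 - 1 / q)) - ε) * u n ≤
      ∫⁻ x, (∑' n, u n * phi d n x) * g x := by
    simp_rw [← ENNReal.tsum_mul_right]
    rw [lintegral_tsum (f := fun n x => u n * phi d n x * g x)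
      (fun n => (((phi_meas d n).const_mul _).mul hgm).aemeasurable), ← ENNReal.tsum_mul_left]
    refine ENNReal.tsum_le_tsum (fun n => ?_)
    simp_rw [mul_assoc]
    rw [lintegral_const_mul (f := fun x => phi d n x * g x) _ ((phi_meas d n).mul hgm), ← mul_assoc, mul_comm _ (u n)]
    exact mul_le_mul_right (low n) _
  have := hS.trans H
  rw [mul_comm κ, ← ENNReal.le_div_iff_mul_le (Or.inl hκ0) (Or.inl hκt)] at this
  refine this.trans (le_of_eq ?_)
  rw [ENNReal.div_eq_inv_mul]
  ring

lemma partB (d : ℕ) (hd : 1 ≤ d) (q : ℝ) (hq : 1 ≤ q) :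
    ∃ C : ℝ≥0∞, C ≠ ∞ ∧ ∀ u : ℕ → ℝ≥0∞,
      (∑' n : ℕ, (((1 + n : ℕ) : ℝ≥0∞) ^ (-((d : ℝ) / 2 * (1 - 1 / q))) * u n) ^ q) ^ (1 / q) ≤
        C * (∫⁻ x, (∑' n, u n * phi d n x) ^ q) ^ (1 / q) := by
  have hq0 : 0 < q := by linarith
  have hq1 : 0 ≤ 1 - 1 / q := by
    rw [sub_nonneg, div_le_one (by linarith)]; exact hq
  set a : ℝ := (d : ℝ) / 2 * (1 - 1 / q) with ha
  set κ : ℝ≥0∞ := ENNReal.ofReal ((1 / 2 : ℝ) ^ d * ((4 : ℝ) ^ (d : ℝ)) ^ (-(1 - 1 / q))) with hκ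
  have hκ0 : κ ≠ 0 := by
    rw [hκ, Ne, ENNReal.ofReal_eq_zero, not_le]; positivity
  have hκt : κ ≠ ∞ := ENNReal.ofReal_ne_top
  have low : ∀ n : ℕ, κ * ((1 + n : ℕ) : ℝ≥0∞) ^ (-a) ≤ (∫⁻ x, phi d n x ^ q) ^ (1 / q) := by
    intro n
    set R := 2 * Real.sqrt ((n : ℝ) + 1) with hR
    have hR0 : 0 < R := by positivity
    set B := Metric.closedBall (0 : Fin d → ℝ) R with hB
    have hvol : volume B = ENNReal.ofReal ((4 * Real.sqrt ((n : ℝ) + 1)) ^ (d : ℝ)) := by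
      rw [hB, Real.volume_pi_closedBall _ hR0.le, Fintype.card_fin, Real.rpow_natCast]
      congr 2; rw [hR]; ring
    have hBm : MeasurableSet B := Metric.isClosed_closedBall.measurableSet
    have H := holder_gen (volume : Measure (Fin d → ℝ)) q hq (phi d n)
      (B.indicator (fun _ => 1)) (phi_meas d n).aemeasurable
      (measurable_const.indicator hBm).aemeasurable
      (fun x => by by_cases h : x ∈ B <;> simp [h]) (volume B) (by
        intro h
        have h1 : 0 < q / (q - 1) := div_pos hq0 (by linarith)
        refine le_of_eq ?_
        rw [← lintegral_indicator_one hBm]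
        refine lintegral_congr (fun x => ?_)
        by_cases hx : x ∈ B
        · simp [hx]
        · simp [hx, h1])
    have e1 : ∫⁻ x, phi d n x * B.indicator (fun _ => 1) x = ∫⁻ x in B, phi d n x := by
      rw [← lintegral_indicator hBm]
      refine lintegral_congr (fun x => ?_)
      by_cases hx : x ∈ B <;> simp [hx]
    rw [e1] at H
    have H2 := (phi_box d n hd).trans H
    have hpos : 0 < (4 * Real.sqrt ((n : ℝ) + 1)) ^ (d : ℝ) := by positivity
    rw [hvol, ENNReal.ofReal_rpow_of_pos hpos] at H2
    have h3 : ENNReal.ofReal (((4 * Real.sqrt ((n : ℝ) + 1)) ^ (d : ℝ)) ^ (1 - 1 / q)) ≠ 0 := by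
      rw [Ne, ENNReal.ofReal_eq_zero, not_le]; positivity
    rw [← ENNReal.div_le_iff_le_mul (Or.inl h3) (Or.inl ENNReal.ofReal_ne_top)] at H2
    refine le_trans (le_of_eq ?_) H2
    rw [natcast_rpow, hκ, ← ENNReal.ofReal_mul (by positivity),
      ← ENNReal.ofReal_div_of_pos (by positivity)]
    congr 1
    rw [div_eq_mul_inv ((1 / 2 : ℝ) ^ d), ← Real.rpow_neg (by positivity), Real.mul_rpow (by norm_num) (by positivity),
      Real.mul_rpow (by positivity) (by positivity), sqrt_rpow, ← Real.rpow_mul (by positivity) (_ / 2),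
      mul_assoc]
    congr 3
    rw [ha]; ring
  refine ⟨κ⁻¹, ENNReal.inv_ne_top.2 hκ0, fun u => ?_⟩
  have key : ∀ n : ℕ, (((1 + n : ℕ) : ℝ≥0∞) ^ (-a) * u n) ^ q ≤
      (κ⁻¹) ^ q * ∫⁻ x, (u n * phi d n x) ^ q := by
    intro n
    have h1 : ((1 + n : ℕ) : ℝ≥0∞) ^ (-a) ≤ κ⁻¹ * (∫⁻ x, phi d n x ^ q) ^ (1 / q) := by
      have := low n
      rw [mul_comm κ, ← ENNReal.le_div_iff_mul_le (Or.inl hκ0) (Or.inl hκt), ENNReal.div_eq_inv_mul] at this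
      exact this
    simp_rw [ENNReal.mul_rpow_of_nonneg _ _ hq0.le]
    rw [lintegral_const_mul _ ((phi_meas d n).pow_const q)]
    have h2 := ENNReal.rpow_le_rpow h1 hq0.le
    rw [ENNReal.mul_rpow_of_nonneg _ _ hq0.le, ← ENNReal.rpow_mul _ (1 / q) q, one_div_mul_cancel hq0.ne',
      ENNReal.rpow_one] at h2
    refine (mul_le_mul_left h2 _).trans (le_of_eq ?_)
    ring
  have tot : ∑' n : ℕ, (((1 + n : ℕ) : ℝ≥0∞) ^ (-a) * u n) ^ q ≤
      (κ⁻¹) ^ q * ∫⁻ x, (∑' n, u n * phi d n x) ^ q := by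
    refine (ENNReal.tsum_le_tsum key).trans ?_
    rw [ENNReal.tsum_mul_left]
    refine mul_le_mul_right ?_ _
    rw [← lintegral_tsum (fun n => (((phi_meas d n).const_mul _).pow_const q).aemeasurable)]
    exact lintegral_mono (fun x => tsum_rpow_le q hq _)
  have := ENNReal.rpow_le_rpow tot (by positivity : 0 ≤ 1 / q)
  rwa [ENNReal.mul_rpow_of_nonneg _ _ (by positivity), ← ENNReal.rpow_mul,
    mul_one_div_cancel hq0.ne', ENNReal.rpow_one] at this

/-- Theorem 6.4 / inequality (122), converse probabilistic Sobolev bounds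
for the harmonic oscillator: the `ℋ^{−d(1/2−1/p)−ε}` norm and the `ℓ^p`-type quantity are
controlled by the probabilistic Lebesgue norm. -/
theorem stmt14 (d : ℕ) (hd : 2 ≤ d) (p : ℝ) (hp : 2 ≤ p) (ε : ℝ) (hε : 0 < ε) :
    ∃ C : ℝ, 1 ≤ C ∧
      ∀ c : ℕ → ℝ, (∀ n, 0 ≤ c n) →
        (∑' n : ℕ, ((1 + n : ℕ) : ℝ≥0∞) ^ (-(d : ℝ) * (1 / 2 - 1 / p) - ε) *
              ENNReal.ofReal ((c n) ^ 2)) ^ (1 / 2 : ℝ)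
          + (∑' n : ℕ, (((1 + n : ℕ) : ℝ≥0∞) ^ (-(d : ℝ) * (1 / 2 - 1 / p)) *
              ENNReal.ofReal ((c n) ^ 2)) ^ (p / 2)) ^ (1 / p)
          ≤ ENNReal.ofReal C * hermitePLnorm d p c := by
  have hq : 1 ≤ p / 2 := by linarith
  have hp0 : 0 < p := by linarith
  obtain ⟨CA, hCA, hA⟩ := partA d (by omega) (p / 2) hq ε hε
  obtain ⟨CB, hCB, hB⟩ := partB d (by omega) (p / 2) hq
  set M : ℝ≥0∞ := CA ^ (1 / 2 : ℝ) + CB ^ (1 / 2 : ℝ) with hM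
  have hMt : M ≠ ∞ := ENNReal.add_ne_top.2
    ⟨ENNReal.rpow_ne_top_of_nonneg (by norm_num) hCA,
      ENNReal.rpow_ne_top_of_nonneg (by norm_num) hCB⟩
  refine ⟨max 1 M.toReal, le_max_left _ _, fun c hc => ?_⟩
  set u : ℕ → ℝ≥0∞ := fun n => ENNReal.ofReal ((c n) ^ 2) with hu
  have hexp : -(d : ℝ) * (1 / 2 - 1 / p) = -((d : ℝ) / 2 * (1 - 1 / (p / 2))) := by
    field_simp
  have hp2 : (1 : ℝ) / p = 1 / (p / 2) * (1 / 2) := by field_simp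
  have hN : hermitePLnorm d p c =
      ((∫⁻ x, (∑' n, u n * phi d n x) ^ (p / 2)) ^ (1 / (p / 2))) ^ (1 / 2 : ℝ) := by
    unfold hermitePLnorm
    rw [← ENNReal.rpow_mul, ← hp2]
    congr 1
    refine lintegral_congr (fun x => ?_)
    congr 2
    funext n
    rw [hu, phi, ← ENNReal.ofReal_mul (sq_nonneg _), mul_div_assoc]
  rw [hN, hexp]
  have h1 := ENNReal.rpow_le_rpow (hA u) (by norm_num : (0 : ℝ) ≤ 1 / 2)
  have h2 := ENNReal.rpow_le_rpow (hB u) (by norm_num : (0 : ℝ) ≤ 1 / 2)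
  rw [ENNReal.mul_rpow_of_nonneg _ _ (by norm_num)] at h1 h2
  rw [← ENNReal.rpow_mul _ (1 / (p / 2)) (1 / 2), ← hp2] at h2
  refine (add_le_add h1 h2).trans ?_
  rw [← add_mul]
  refine mul_le_mul_left ?_ _
  rw [← hM, ← ENNReal.ofReal_toReal hMt]
  refine ENNReal.ofReal_le_ofReal ?_
  rw [ENNReal.toReal_ofReal ENNReal.toReal_nonneg]
  exact le_max_right _ _
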